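/- arXiv:2204.07505 — 2 statements merged into one kernel-verified Lean document; each statement's English description precedes it below -/
import Mathlib

section
/- Let n ≥ 2 and let μ ∈ {0,1,…,2n−1}. Then the n-th roots of unity can be enumerated as R_1,…,R_n (the enumeration depending on μ) in such a way that for every complex number ρ ≠ 0 with arg ρ ∈ (μπ/n, (μ+1)π/n) one has Re(ρR_1) < Re(ρR_2) < … < Re(ρR_n). -/
open Complex Set

/-- Each width-one band of distances from the origin contains a translate `m + t`, `t ∈ (0, 1)`,
by an integer `m` of prescribed parity. -/
lemma exists_even_sub_abs_add_mem_Ioo (a : ℤ) (d : ℕ) :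
    ∃ m : ℤ, Even (m - a) ∧ ∀ t : ℝ, t ∈ Ioo (0 : ℝ) 1 → |(m : ℝ) + t| ∈ Ioo (d : ℝ) (d + 1) := by
  have hd : (0 : ℝ) ≤ d := d.cast_nonneg
  rcases Int.even_or_odd ((d : ℤ) - a) with h | h
  · refine ⟨d, h, fun t ht => ?_⟩
    rw [Int.cast_natCast, abs_of_pos (by linarith [ht.1])]
    exact ⟨by linarith [ht.1], by linarith [ht.2]⟩
  · refine ⟨-(d + 1), by grind, fun t ht => ?_⟩
    push_cast
    rw [abs_of_neg (by linarith [ht.2])]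
    exact ⟨by linarith [ht.2], by linarith [ht.1]⟩

lemma re_mul_exp_mul_exp (r x y : ℝ) :
    (((r : ℂ) * exp (x * I)) * exp (y * I)).re = r * Real.cos (x + y) := by
  rw [mul_assoc, ← Complex.exp_add, ← add_mul, ← ofReal_add, re_ofReal_mul, exp_ofReal_mul_I_re]

/-- For `n ≥ 2` and `μ ∈ {0,…,2n−1}`, the `n`-th roots of unity can be
enumerated as `R 0, …, R (n-1)` (enumeration depending on `μ`) so that for every nonzero
complex `ρ` with argument in the open sector `(μπ/n, (μ+1)π/n)` (understood mod 2π, i.e.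
`ρ = r·exp(iθ)` with `r > 0` and `θ` in that interval) one has
`Re(ρ R 0) < Re(ρ R 1) < … < Re(ρ R (n-1))`. -/
theorem roots_of_unity_sector_ordering (n : ℕ) (hn : 2 ≤ n) (μ : ℕ) (hμ : μ ≤ 2 * n - 1) :
    ∃ R : Fin n → ℂ, Function.Injective R ∧ (∀ k, R k ^ n = 1) ∧
      ∀ (r θ : ℝ), 0 < r →
        θ ∈ Set.Ioo ((μ : ℝ) * Real.pi / n) (((μ : ℝ) + 1) * Real.pi / n) →
        ∀ k l : Fin n, k < l →
          (((r : ℂ) * Complex.exp (θ * Complex.I)) * R k).re <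
            (((r : ℂ) * Complex.exp (θ * Complex.I)) * R l).re := by
  have hn0 : (0 : ℝ) < n := by positivity
  choose m hme hm using exists_even_sub_abs_add_mem_Ioo (μ : ℤ)
  let R : Fin n → ℂ := fun k =>
    exp ((((m (n - 1 - k) : ℝ) - μ) * Real.pi / n : ℝ) * I)
  have key : ∀ (r θ : ℝ), 0 < r →
      θ ∈ Set.Ioo ((μ : ℝ) * Real.pi / n) (((μ : ℝ) + 1) * Real.pi / n) →
      ∀ k l : Fin n, k < l →
        (((r : ℂ) * Complex.exp (θ * Complex.I)) * R k).re <
          (((r : ℂ) * Complex.exp (θ * Complex.I)) * R l).re := by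
    intro r θ hr hθ k l hkl
    obtain ⟨t, rfl⟩ : ∃ t : ℝ, θ = (μ + t) * Real.pi / n :=
      ⟨θ * n / Real.pi - μ, by field_simp; ring⟩
    have ht : t ∈ Ioo (0 : ℝ) 1 := by
      obtain ⟨h1, h2⟩ := hθ
      rw [div_lt_div_iff_of_pos_right hn0, mul_lt_mul_iff_left₀ Real.pi_pos] at h1 h2
      exact ⟨by linarith, by linarith⟩
    have cos_eq (d : ℕ) : Real.cos ((μ + t) * Real.pi / n + ((m d : ℝ) - μ) * Real.pi / n) =
        Real.cos (|(m d : ℝ) + t| * (Real.pi / n)) := by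
      rw [← Real.cos_abs (|_| * _), abs_mul, abs_abs, ← abs_mul, Real.cos_abs]
      congr 1
      ring
    simp only [R, re_mul_exp_mul_exp, cos_eq]
    have hk := hm (n - 1 - k) t ht
    have hl := hm (n - 1 - l) t ht
    have hlt : ((n - 1 - l : ℕ) : ℝ) + 1 ≤ (n - 1 - k : ℕ) := by
      exact_mod_cast (by omega : n - 1 - (l : ℕ) + 1 ≤ n - 1 - k)
    have hle : ((n - 1 - k : ℕ) : ℝ) + 1 ≤ n := by
      exact_mod_cast (by omega : n - 1 - (k : ℕ) + 1 ≤ n)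
    refine mul_lt_mul_of_pos_left (Real.cos_lt_cos_of_nonneg_of_le_pi (by positivity) ?_ ?_) hr
    · calc _ ≤ (n : ℝ) * (Real.pi / n) := by
            gcongr
            linarith [hk.2]
        _ = Real.pi := by field_simp
    · gcongr
      linarith [hk.1, hl.2]
  refine ⟨R, ?_, fun k => ?_, key⟩
  · have hmid : ((μ : ℝ) + 1 / 2) * Real.pi / n ∈
        Set.Ioo ((μ : ℝ) * Real.pi / n) (((μ : ℝ) + 1) * Real.pi / n) := by
      constructor <;> gcongr <;> norm_num
    have hmono : StrictMono fun k => (((1 : ℝ) : ℂ) *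
        Complex.exp ((((μ : ℝ) + 1 / 2) * Real.pi / n : ℝ) * Complex.I) * R k).re :=
      fun k l hkl => key 1 _ one_pos hmid k l hkl
    exact fun k l h => hmono.injective (by simp only [h])
  · obtain ⟨c, hc⟩ := hme (n - 1 - k)
    have hc' : (m (n - 1 - k) : ℝ) - μ = c + c := by exact_mod_cast hc
    have hnc : (n : ℂ) ≠ 0 := by exact_mod_cast hn0.ne'
    simp only [R]
    rw [hc', ← Complex.exp_nat_mul, Complex.exp_eq_one_iff]
    refine ⟨c, ?_⟩
    push_cast
    field_simp
    ring
end

section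
/- Let z_{νk}(x,ρ) be the unique solution of the integral system z_{νk}(x,ρ) = 1 + Σ_{m=0}^{n−2} ∫_α^T A_{νmk}(x,t,ρ) z_{mk}(t,ρ) dt for ρ ∈ S̄, |ρ| ≥ ρ_α. Then z_{νk}(x,ρ) = 1 + β_1(x)/(ρR_k) + o(1/ρ) as |ρ| → ∞, ρ ∈ S̄, uniformly in x ∈ [α,T], for every k ∈ {1,…,n} and ν ∈ {0,…,n−1}, where β_1(x) = −(1/n)∫_α^x p_{n−2}(t) dt. -/
open MeasureTheory Set Finset

/-- The kernel `A_{νmk}(x,t,ρ)` of (1.7) (0-based indices, see the paper). -/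
noncomputable def birkhoffKernel (n : ℕ) (R : Fin n → ℂ) (p : Fin (n - 1) → ℝ → ℂ)
    (ρ : ℂ) (ν : Fin n) (m : Fin (n - 1)) (k : Fin n) (x t : ℝ) : ℂ :=
  if t ≤ x then
    -(p m t / ((n : ℂ) * ρ ^ (n - 1 - (m : ℕ)))) *
      ∑ j ∈ Finset.Iic k, R j ^ ((ν : ℕ) + 1) * R k ^ (((m : ℕ) : ℤ) - ((ν : ℕ) : ℤ)) *
        Complex.exp (ρ * (R j - R k) * (x - t))
  else
    (p m t / ((n : ℂ) * ρ ^ (n - 1 - (m : ℕ)))) *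
      ∑ j ∈ Finset.Ioi k, R j ^ ((ν : ℕ) + 1) * R k ^ (((m : ℕ) : ℤ) - ((ν : ℕ) : ℤ)) *
        Complex.exp (ρ * (R j - R k) * (x - t))

/-- `ρ_α := max_{0≤m≤n−2} (2∫_α^T |p_m(t)| dt)^{1/(n−1−m)}`. -/
noncomputable def rhoAlpha (n : ℕ) (T α : ℝ) (p : Fin (n - 1) → ℝ → ℂ) : ℝ :=
  ⨆ m : Fin (n - 1), (2 * ∫ t in α..T, ‖p m t‖) ^ (((n : ℝ) - 1 - (m : ℕ))⁻¹)

/-- `z = (z_{0k},…,z_{n−1,k})` is a bounded measurable solution on `[α,T]` of the system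
(1.6): `z_{νk}(x) = 1 + Σ_{m=0}^{n−2} ∫_α^T A_{νmk}(x,t,ρ) z_{mk}(t) dt`. -/
def SolvesZSystem (n : ℕ) (T α : ℝ) (R : Fin n → ℂ) (p : Fin (n - 1) → ℝ → ℂ)
    (ρ : ℂ) (k : Fin n) (z : Fin n → ℝ → ℂ) : Prop :=
  (∀ ν, Measurable (z ν)) ∧
  (∃ M : ℝ, ∀ ν, ∀ x ∈ Set.Icc α T, ‖z ν x‖ ≤ M) ∧
  ∀ ν : Fin n, ∀ x ∈ Set.Icc α T,
    z ν x = 1 + ∑ m : Fin (n - 1),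
      ∫ t in α..T, birkhoffKernel n R p ρ ν m k x t * z (Fin.castLE (Nat.sub_le n 1) m) t

theorem norm_integral_mul_cexp_le_of_contDiff {g : ℝ → ℂ} (hg : ContDiff ℝ 1 g) {C C' : ℝ}
    (hC : ∀ t, ‖g t‖ ≤ C) (hC' : ∀ t, ‖deriv g t‖ ≤ C') {c d s : ℝ} (hcd : c ≤ d) {w : ℂ}
    (hw : w ≠ 0) (hre : ∀ t ∈ Set.Icc c d, (w * (s - t)).re ≤ 0) :
    ‖∫ t in c..d, g t * Complex.exp (w * (s - t))‖ ≤ (2 * C + C' * (d - c)) / ‖w‖ := by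
  have hexp : ∀ t ∈ Set.Icc c d, ‖Complex.exp (w * (s - t))‖ ≤ 1 := fun t ht => by
    rw [Complex.norm_exp]
    exact Real.exp_le_one_iff.2 (hre t ht)
  have hC0 : 0 ≤ C := (norm_nonneg _).trans (hC 0)
  have hC'0 : 0 ≤ C' := (norm_nonneg _).trans (hC' 0)
  have hcont : Continuous fun t : ℝ => Complex.exp (w * (s - t)) := by fun_prop
  have hd : ∀ t : ℝ, HasDerivAt (fun t : ℝ => -(1 / w) * Complex.exp (w * (s - t)))
      (Complex.exp (w * (s - t))) t := by
    intro t
    have h2 : HasDerivAt (fun t : ℝ => w * ((s : ℂ) - t)) (w * (-1)) t :=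
      (Complex.ofRealCLM.hasDerivAt.const_sub (s : ℂ)).const_mul w
    refine (h2.cexp.const_mul (-(1 / w))).congr_deriv ?_
    field_simp
  have hparts := intervalIntegral.integral_mul_deriv_eq_deriv_mul (a := c) (b := d)
    (fun t _ => (hg.differentiable one_ne_zero t).hasDerivAt) (fun t _ => hd t)
    ((hg.continuous_deriv le_rfl).intervalIntegrable _ _) (hcont.intervalIntegrable _ _)
  have hv : ∀ t ∈ Set.Icc c d, ‖-(1 / w) * Complex.exp (w * (s - t))‖ ≤ 1 / ‖w‖ := by
    intro t ht
    rw [norm_mul, norm_neg, norm_div, norm_one]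
    exact mul_le_of_le_one_right (by positivity) (hexp t ht)
  have hI : ‖∫ t in c..d, deriv g t * (-(1 / w) * Complex.exp (w * (s - t)))‖
      ≤ C' * (1 / ‖w‖) * |d - c| := by
    refine intervalIntegral.norm_integral_le_of_norm_le_const fun t ht => ?_
    rw [Set.uIoc_of_le hcd] at ht
    rw [norm_mul]
    exact mul_le_mul (hC' t) (hv t (Set.Ioc_subset_Icc_self ht)) (norm_nonneg _) hC'0
  have hB : ∀ t ∈ Set.Icc c d, ‖g t * (-(1 / w) * Complex.exp (w * (s - t)))‖
      ≤ C * (1 / ‖w‖) := by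
    intro t ht
    rw [norm_mul]
    exact mul_le_mul (hC t) (hv t ht) (norm_nonneg _) hC0
  rw [hparts]
  rw [abs_of_nonneg (sub_nonneg.2 hcd)] at hI
  calc _ ≤ C * (1 / ‖w‖) + C * (1 / ‖w‖) + C' * (1 / ‖w‖) * (d - c) :=
        (norm_sub_le _ _).trans (add_le_add ((norm_sub_le _ _).trans
          (add_le_add (hB d (Set.right_mem_Icc.2 hcd)) (hB c (Set.left_mem_Icc.2 hcd)))) hI)
    _ = _ := by ring

/-- A Riemann–Lebesgue lemma for complex frequencies: the oscillatory integral is small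
uniformly over all subintervals and all shifts on which the exponential is bounded by one. -/
theorem exists_norm_integral_mul_cexp_le {f : ℝ → ℂ} {a b : ℝ}
    (hf : IntervalIntegrable f volume a b) {δ : ℝ} (hδ : 0 < δ) :
    ∃ N > (0 : ℝ), ∀ c d s : ℝ, a ≤ c → c ≤ d → d ≤ b → ∀ w : ℂ, N ≤ ‖w‖ →
      (∀ t ∈ Set.Icc c d, (w * (s - t)).re ≤ 0) →
      ‖∫ t in c..d, f t * Complex.exp (w * (s - t))‖ ≤ δ := by
  rcases lt_or_ge b a with hab | hab
  · exact ⟨1, one_pos, fun c d s h1 h2 h3 => by linarith⟩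
  have hfi : Integrable f (volume.restrict (Set.Ioc a b)) := hf.1
  obtain ⟨g, hgs, hg, hfg⟩ := (memLp_one_iff_integrable.2 hfi).exist_eLpNorm_sub_le
    (by simp) le_rfl (half_pos hδ)
  obtain ⟨C, hC⟩ := hgs.exists_bound_of_continuous hg.continuous
  have hg1 : ContDiff ℝ 1 g := hg.of_le (by exact_mod_cast le_top)
  obtain ⟨C', hC'⟩ := hgs.deriv.exists_bound_of_continuous (hg1.continuous_deriv le_rfl)
  have hC0 : 0 ≤ C := (norm_nonneg _).trans (hC 0)
  have hC'0 : 0 ≤ C' := (norm_nonneg _).trans (hC' 0)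
  have hgi : Integrable g (volume.restrict (Set.Ioc a b)) :=
    (hg.continuous.integrable_of_hasCompactSupport hgs).restrict
  have hdist : ∫ t in Set.Ioc a b, ‖f t - g t‖ ≤ δ / 2 := by
    rw [eLpNorm_one_eq_lintegral_enorm] at hfg
    have h := integral_norm_eq_lintegral_enorm (hfi.sub hgi).aestronglyMeasurable
    simp only [Pi.sub_apply] at h hfg
    rw [h]
    exact ENNReal.toReal_le_of_le_ofReal (half_pos hδ).le hfg
  refine ⟨(2 * C + C' * (b - a)) / (δ / 2) + 1, ?_, fun c d s hac hcd hdb w hw hre => ?_⟩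
  · have := sub_nonneg.2 hab
    positivity
  have hM0 : 0 ≤ 2 * C + C' * (b - a) := by
    have := sub_nonneg.2 hab
    positivity
  have hw0 : 0 < ‖w‖ := lt_of_lt_of_le (by positivity) hw
  have hsub : Set.Ioc c d ⊆ Set.Ioc a b := Set.Ioc_subset_Ioc hac hdb
  have hcont : Continuous fun t : ℝ => Complex.exp (w * (s - t)) := by fun_prop
  have hfcd : IntervalIntegrable f volume c d :=
    (intervalIntegrable_iff_integrableOn_Ioc_of_le hcd).2 (IntegrableOn.mono_set hfi hsub)
  have hgcd : IntervalIntegrable g volume c d := hg.continuous.intervalIntegrable _ _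
  have hsplit : ∫ t in c..d, f t * Complex.exp (w * (s - t))
      = (∫ t in c..d, (f t - g t) * Complex.exp (w * (s - t)))
        + ∫ t in c..d, g t * Complex.exp (w * (s - t)) := by
    rw [← intervalIntegral.integral_add
      ((hfcd.sub hgcd).mul_continuousOn hcont.continuousOn)
      (hgcd.mul_continuousOn hcont.continuousOn)]
    congr 1
    ext t
    ring
  have h1 : ‖∫ t in c..d, (f t - g t) * Complex.exp (w * (s - t))‖ ≤ δ / 2 := by
    calc _ ≤ ∫ t in c..d, ‖f t - g t‖ := by
          refine intervalIntegral.norm_integral_le_of_norm_le hcd (.of_forall fun t ht => ?_)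
            (hfcd.sub hgcd).norm
          rw [norm_mul, Complex.norm_exp]
          exact mul_le_of_le_one_right (norm_nonneg _)
            (Real.exp_le_one_iff.2 (hre t (Set.Ioc_subset_Icc_self ht)))
      _ ≤ ∫ t in Set.Ioc a b, ‖f t - g t‖ := by
          rw [intervalIntegral.integral_of_le hcd]
          exact setIntegral_mono_set (hfi.sub hgi).norm
            (.of_forall fun t => norm_nonneg _) hsub.eventuallyLE
      _ ≤ δ / 2 := hdist
  have h2 : ‖∫ t in c..d, g t * Complex.exp (w * (s - t))‖ ≤ δ / 2 := by
    refine (norm_integral_mul_cexp_le_of_contDiff hg1 hC hC' hcd (norm_pos_iff.1 hw0)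
      hre).trans ?_
    rw [div_le_iff₀ hw0]
    have h3 : (2 * C + C' * (b - a)) / (δ / 2) ≤ ‖w‖ := by linarith
    rw [div_le_iff₀ (half_pos hδ)] at h3
    have h4 : C' * (d - c) ≤ C' * (b - a) := mul_le_mul_of_nonneg_left (by linarith) hC'0
    linarith
  rw [hsplit]
  exact (norm_add_le _ _).trans (by linarith)

theorem re_mul_le_of_mem_closure {ι : Type*} [PartialOrder ι] {R : ι → ℂ} {S : Set ℂ}
    (hS : ∀ ρ ∈ S, ∀ k l : ι, k < l → (ρ * R k).re < (ρ * R l).re) {ρ : ℂ}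
    (hρ : ρ ∈ closure S) {k l : ι} (hkl : k ≤ l) : (ρ * R k).re ≤ (ρ * R l).re := by
  rcases hkl.eq_or_lt with rfl | hlt
  · exact le_rfl
  have hclosed : IsClosed {ρ : ℂ | (ρ * R k).re ≤ (ρ * R l).re} :=
    isClosed_le (by fun_prop) (by fun_prop)
  exact closure_minimal (fun σ hσ => (hS σ hσ k l hlt).le) hclosed hρ

theorem re_mul_sub_mul_sub (ρ a b : ℂ) (x t : ℝ) :
    (ρ * (a - b) * (x - t)).re = ((ρ * a).re - (ρ * b).re) * (x - t) := by
  rw [← Complex.ofReal_sub, Complex.re_mul_ofReal, mul_sub ρ, Complex.sub_re]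

theorem birkhoffKernel_eq_mul (n : ℕ) (R : Fin n → ℂ) (p : Fin (n - 1) → ℝ → ℂ)
    (ρ : ℂ) (ν : Fin n) (m : Fin (n - 1)) (k : Fin n) (x t : ℝ) :
    birkhoffKernel n R p ρ ν m k x t
      = birkhoffKernel n R (fun _ _ => 1) ρ ν m k x t * p m t := by
  unfold birkhoffKernel
  split_ifs <;> ring

theorem measurable_birkhoffKernel_one (n : ℕ) (R : Fin n → ℂ)
    (ρ : ℂ) (ν : Fin n) (m : Fin (n - 1)) (k : Fin n) (x : ℝ) :
    Measurable fun t => birkhoffKernel n R (fun _ _ => 1) ρ ν m k x t := by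
  unfold birkhoffKernel
  refine Measurable.ite measurableSet_Iic ?_ ?_ <;> exact Continuous.measurable (by fun_prop)

theorem norm_birkhoffKernel_le {n : ℕ} {R : Fin n → ℂ} (hR : ∀ j, ‖R j‖ = 1)
    (p : Fin (n - 1) → ℝ → ℂ) {ρ : ℂ}
    (hre : ∀ k l : Fin n, k ≤ l → (ρ * R k).re ≤ (ρ * R l).re)
    (ν : Fin n) (m : Fin (n - 1)) (k : Fin n) (x t : ℝ) :
    ‖birkhoffKernel n R p ρ ν m k x t‖ ≤ ‖p m t‖ / ‖ρ‖ ^ (n - 1 - (m : ℕ)) := by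
  have hn : (0 : ℝ) < n := Nat.cast_pos.2 k.pos
  have hsum : ∀ s : Finset (Fin n), (∀ j ∈ s, (ρ * (R j - R k) * (x - t)).re ≤ 0) →
      ‖∑ j ∈ s, R j ^ ((ν : ℕ) + 1) * R k ^ (((m : ℕ) : ℤ) - ((ν : ℕ) : ℤ)) *
        Complex.exp (ρ * (R j - R k) * (x - t))‖ ≤ n := by
    intro s hs
    calc _ ≤ ∑ j ∈ s, (1 : ℝ) := by
          refine norm_sum_le_of_le _ fun j hj => ?_
          rw [norm_mul, norm_mul, norm_pow, norm_zpow, hR, hR, one_pow, one_zpow, one_mul,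
            one_mul, Complex.norm_exp]
          exact Real.exp_le_one_iff.2 (hs j hj)
      _ ≤ n := by
          rw [Finset.sum_const, nsmul_one]
          exact_mod_cast (Finset.card_le_univ s).trans_eq (Fintype.card_fin n)
  have hcoef : ‖p m t / ((n : ℂ) * ρ ^ (n - 1 - (m : ℕ)))‖ * n
      = ‖p m t‖ / ‖ρ‖ ^ (n - 1 - (m : ℕ)) := by
    rw [norm_div, norm_mul, norm_pow, Complex.norm_natCast, div_mul_eq_mul_div, mul_comm,
      mul_div_mul_left _ _ hn.ne']
  rw [← hcoef]
  unfold birkhoffKernel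
  split_ifs with h
  · rw [norm_mul, norm_neg]
    refine mul_le_mul_of_nonneg_left (hsum _ fun j hj => ?_) (norm_nonneg _)
    rw [re_mul_sub_mul_sub]
    exact mul_nonpos_of_nonpos_of_nonneg
      (sub_nonpos.2 (hre _ _ (Finset.mem_Iic.1 hj))) (sub_nonneg.2 h)
  · rw [norm_mul]
    refine mul_le_mul_of_nonneg_left (hsum _ fun j hj => ?_) (norm_nonneg _)
    rw [re_mul_sub_mul_sub]
    exact mul_nonpos_of_nonneg_of_nonpos
      (sub_nonneg.2 (hre _ _ (Finset.mem_Ioi.1 hj).le)) (sub_nonpos.2 (not_le.1 h).le)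

theorem norm_integral_birkhoffKernel_mul_le {n : ℕ} {R : Fin n → ℂ} (hR : ∀ j, ‖R j‖ = 1)
    {p : Fin (n - 1) → ℝ → ℂ} {ρ : ℂ}
    (hre : ∀ k l : Fin n, k ≤ l → (ρ * R k).re ≤ (ρ * R l).re)
    (ν : Fin n) (m : Fin (n - 1)) (k : Fin n) (x : ℝ) {α T : ℝ} (hαT : α ≤ T)
    (hp : IntervalIntegrable (p m) volume α T) {u : ℝ → ℂ} {C : ℝ}
    (hu : ∀ t ∈ Set.Icc α T, ‖u t‖ ≤ C) :
    ‖∫ t in α..T, birkhoffKernel n R p ρ ν m k x t * u t‖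
      ≤ (∫ t in α..T, ‖p m t‖) / ‖ρ‖ ^ (n - 1 - (m : ℕ)) * C := by
  have h := intervalIntegral.norm_integral_le_of_norm_le hαT (μ := volume)
    (f := fun t => birkhoffKernel n R p ρ ν m k x t * u t)
    (g := fun t => ‖p m t‖ / ‖ρ‖ ^ (n - 1 - (m : ℕ)) * C)
    (.of_forall fun t ht => by
      rw [norm_mul]
      exact mul_le_mul (norm_birkhoffKernel_le hR p hre ν m k x t)
        (hu t (Set.Ioc_subset_Icc_self ht)) (norm_nonneg _) (by positivity))
    ((hp.norm.div_const _).mul_const _)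
  rwa [intervalIntegral.integral_mul_const, intervalIntegral.integral_div] at h

theorem intervalIntegrable_birkhoffKernel_mul {n : ℕ} {R : Fin n → ℂ} (hR : ∀ j, ‖R j‖ = 1)
    {p : Fin (n - 1) → ℝ → ℂ} {ρ : ℂ}
    (hre : ∀ k l : Fin n, k ≤ l → (ρ * R k).re ≤ (ρ * R l).re)
    (ν : Fin n) (m : Fin (n - 1)) (k : Fin n) (x : ℝ) {α T : ℝ} (hαT : α ≤ T)
    (hp : IntervalIntegrable (p m) volume α T) {u : ℝ → ℂ} (hum : Measurable u) {C : ℝ}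
    (hu : ∀ t ∈ Set.Icc α T, ‖u t‖ ≤ C) :
    IntervalIntegrable (fun t => birkhoffKernel n R p ρ ν m k x t * u t) volume α T := by
  rw [intervalIntegrable_iff_integrableOn_Ioc_of_le hαT] at hp ⊢
  have h1 : Integrable (fun t => birkhoffKernel n R p ρ ν m k x t)
      (volume.restrict (Set.Ioc α T)) := by
    simp_rw [birkhoffKernel_eq_mul n R p]
    refine Integrable.bdd_mul (c := 1 / ‖ρ‖ ^ (n - 1 - (m : ℕ))) hp
      (measurable_birkhoffKernel_one n R ρ ν m k x).aestronglyMeasurable (.of_forall fun t => ?_)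
    simpa using norm_birkhoffKernel_le hR (fun _ _ => 1) hre ν m k x t
  refine h1.mul_bdd (c := C) hum.aestronglyMeasurable ?_
  filter_upwards [ae_restrict_mem measurableSet_Ioc] with t ht
  exact hu t (Set.Ioc_subset_Icc_self ht)

/-- The part of the kernel integral for `m = n - 2` that does not oscillate is the
second-order term of the expansion; the oscillating parts are controlled by `δ`. -/
theorem norm_integral_birkhoffKernel_sub_le {n : ℕ} {R : Fin n → ℂ} (hR : ∀ j, ‖R j‖ = 1)
    (hroot : ∀ j, R j ^ n = 1) {p : Fin (n - 1) → ℝ → ℂ} {ρ : ℂ}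
    (hre : ∀ k l : Fin n, k ≤ l → (ρ * R k).re ≤ (ρ * R l).re)
    (ν : Fin n) {m : Fin (n - 1)} (hm : (m : ℕ) + 2 = n) (k : Fin n) {α T x : ℝ}
    (hx : x ∈ Set.Icc α T) (hp : IntervalIntegrable (p m) volume α T) {δ : ℝ}
    (hδ : 0 ≤ δ)
    (hosc : ∀ j, j ≠ k → ∀ c d s : ℝ, α ≤ c → c ≤ d → d ≤ T →
      (∀ t ∈ Set.Icc c d, (ρ * (R j - R k) * (s - t)).re ≤ 0) →
      ‖∫ t in c..d, p m t * Complex.exp (ρ * (R j - R k) * (s - t))‖ ≤ δ) :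
    ‖(∫ t in α..T, birkhoffKernel n R p ρ ν m k x t)
      - (-(1 / (n : ℂ)) * ∫ t in α..x, p m t) / (ρ * R k)‖ ≤ δ / ‖ρ‖ := by
  have hn : (0 : ℝ) < n := Nat.cast_pos.2 k.pos
  have hRk : R k ≠ 0 := norm_ne_zero_iff.1 (by rw [hR]; exact one_ne_zero)
  have hexpo : n - 1 - (m : ℕ) = 1 := by omega
  have hpow : R k ^ ((ν : ℕ) + 1) * R k ^ (((m : ℕ) : ℤ) - ((ν : ℕ) : ℤ)) = (R k)⁻¹ := by
    rw [← zpow_natCast (R k) ((ν : ℕ) + 1), ← zpow_add₀ hRk]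
    refine eq_inv_of_mul_eq_one_left ?_
    rw [← zpow_add_one₀ hRk, ← hroot k, ← zpow_natCast]
    congr 1
    omega
  have hsubl : Set.uIcc α x ⊆ Set.uIcc α T := by
    rw [Set.uIcc_of_le hx.1, Set.uIcc_of_le (hx.1.trans hx.2)]
    exact Set.Icc_subset_Icc_right hx.2
  have hsubr : Set.uIcc x T ⊆ Set.uIcc α T := by
    rw [Set.uIcc_of_le hx.2, Set.uIcc_of_le (hx.1.trans hx.2)]
    exact Set.Icc_subset_Icc_left hx.1
  have hcont : ∀ j, Continuous fun t : ℝ => Complex.exp (ρ * (R j - R k) * (x - t)) :=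
    fun j => by fun_prop
  set a : Fin n → ℂ := fun j =>
    R j ^ ((ν : ℕ) + 1) * R k ^ (((m : ℕ) : ℤ) - ((ν : ℕ) : ℤ)) / (n * ρ) with ha
  have hanorm : ∀ j, ‖a j‖ = 1 / (n * ‖ρ‖) := by
    intro j
    simp [ha, hR]
  have hterm : ∀ (b c : ℝ) (s : Finset (Fin n)), IntervalIntegrable (p m) volume b c →
      ∫ t in b..c, ∑ j ∈ s, a j * (p m t * Complex.exp (ρ * (R j - R k) * (x - t)))
        = ∑ j ∈ s, a j * ∫ t in b..c, p m t * Complex.exp (ρ * (R j - R k) * (x - t)) := by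
    intro b c s hbc
    rw [intervalIntegral.integral_finsetSum fun j _ =>
      (hbc.mul_continuousOn (hcont j).continuousOn).const_mul _]
    simp_rw [intervalIntegral.integral_const_mul]
  have hleft : Set.EqOn (fun t => birkhoffKernel n R p ρ ν m k x t)
      (fun t => -∑ j ∈ Finset.Iic k, a j * (p m t * Complex.exp (ρ * (R j - R k) * (x - t))))
      (Set.Ioc α x) := by
    intro t ht
    simp only [birkhoffKernel, if_pos ht.2, hexpo, pow_one, ha, Finset.mul_sum,
      ← Finset.sum_neg_distrib]
    refine Finset.sum_congr rfl fun j _ => ?_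
    ring
  have hright : Set.EqOn (fun t => birkhoffKernel n R p ρ ν m k x t)
      (fun t => ∑ j ∈ Finset.Ioi k, a j * (p m t * Complex.exp (ρ * (R j - R k) * (x - t))))
      (Set.Ioc x T) := by
    intro t ht
    simp only [birkhoffKernel, if_neg (not_le.2 ht.1), hexpo, pow_one, ha, Finset.mul_sum]
    refine Finset.sum_congr rfl fun j _ => ?_
    ring
  have hint := intervalIntegrable_birkhoffKernel_mul hR hre ν m k x (hx.1.trans hx.2) hp
    measurable_one (C := 1) (by simp)
  simp only [Pi.one_apply, mul_one] at hint
  have hkey : (∫ t in α..T, birkhoffKernel n R p ρ ν m k x t)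
      - (-(1 / (n : ℂ)) * ∫ t in α..x, p m t) / (ρ * R k)
      = (∑ j ∈ Finset.Ioi k,
          a j * ∫ t in x..T, p m t * Complex.exp (ρ * (R j - R k) * (x - t)))
        - ∑ j ∈ Finset.Iio k,
          a j * ∫ t in α..x, p m t * Complex.exp (ρ * (R j - R k) * (x - t)) := by
    rw [← intervalIntegral.integral_add_adjacent_intervals
        (hint.mono_set hsubl) (hint.mono_set hsubr),
      intervalIntegral.integral_congr_Ioo_of_le hx.1 (hleft.mono Set.Ioo_subset_Ioc_self),
      intervalIntegral.integral_congr_Ioo_of_le hx.2 (hright.mono Set.Ioo_subset_Ioc_self),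
      intervalIntegral.integral_neg, hterm _ _ _ (hp.mono_set hsubl), hterm _ _ _ (hp.mono_set hsubr),
      ← Finset.Iio_insert, Finset.sum_insert (by simp)]
    have hak : a k = 1 / (n * (ρ * R k)) := by
      simp only [ha, hpow]
      rw [div_eq_mul_inv, one_div, mul_inv, mul_inv, mul_inv]
      ring
    simp only [hak, sub_self, mul_zero, zero_mul, Complex.exp_zero, mul_one]
    ring
  have hlow : ∀ j ∈ Finset.Iio k,
      ‖a j * ∫ t in α..x, p m t * Complex.exp (ρ * (R j - R k) * (x - t))‖
        ≤ 1 / (n * ‖ρ‖) * δ := by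
    intro j hj
    rw [norm_mul, hanorm]
    have hjk := Finset.mem_Iio.1 hj
    refine mul_le_mul_of_nonneg_left
      (hosc j hjk.ne α x x le_rfl hx.1 hx.2 fun t ht => ?_) (by positivity)
    rw [re_mul_sub_mul_sub]
    exact mul_nonpos_of_nonpos_of_nonneg (sub_nonpos.2 (hre _ _ hjk.le)) (sub_nonneg.2 ht.2)
  have hup : ∀ j ∈ Finset.Ioi k,
      ‖a j * ∫ t in x..T, p m t * Complex.exp (ρ * (R j - R k) * (x - t))‖
        ≤ 1 / (n * ‖ρ‖) * δ := by
    intro j hj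
    rw [norm_mul, hanorm]
    have hjk := Finset.mem_Ioi.1 hj
    refine mul_le_mul_of_nonneg_left
      (hosc j hjk.ne' x T x hx.1 hx.2 le_rfl fun t ht => ?_) (by positivity)
    rw [re_mul_sub_mul_sub]
    exact mul_nonpos_of_nonneg_of_nonpos (sub_nonneg.2 (hre _ _ hjk.le)) (sub_nonpos.2 ht.1)
  have hcard : (((Finset.Ioi k).card : ℝ) + (Finset.Iio k).card) ≤ n := by
    rw [Fin.card_Ioi, Fin.card_Iio]
    have := k.isLt
    exact_mod_cast (by omega : n - 1 - (k : ℕ) + k ≤ n)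
  rw [hkey]
  calc _ ≤ (Finset.Ioi k).card • (1 / (n * ‖ρ‖) * δ)
          + (Finset.Iio k).card • (1 / (n * ‖ρ‖) * δ) :=
        (norm_sub_le _ _).trans (add_le_add
          ((norm_sum_le_of_le _ hup).trans_eq (Finset.sum_const _))
          ((norm_sum_le_of_le _ hlow).trans_eq (Finset.sum_const _)))
    _ = (((Finset.Ioi k).card : ℝ) + (Finset.Iio k).card) * (1 / (n * ‖ρ‖) * δ) := by
        rw [nsmul_eq_mul, nsmul_eq_mul, add_mul]
    _ ≤ n * (1 / (n * ‖ρ‖) * δ) := mul_le_mul_of_nonneg_right hcard (by positivity)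
    _ = δ / ‖ρ‖ := by
        rw [one_div, mul_inv]
        field_simp

theorem SolvesZSystem.norm_sub_one_le {n : ℕ} {R : Fin n → ℂ} (hR : ∀ j, ‖R j‖ = 1)
    {p : Fin (n - 1) → ℝ → ℂ} {ρ : ℂ}
    (hre : ∀ k l : Fin n, k ≤ l → (ρ * R k).re ≤ (ρ * R l).re) {α T : ℝ} (hαT : α ≤ T)
    (hp : ∀ m, IntervalIntegrable (p m) volume α T) (hρ1 : 1 ≤ ‖ρ‖)
    (hρ : 2 * ∑ m, ∫ t in α..T, ‖p m t‖ ≤ ‖ρ‖) {k : Fin n} {z : Fin n → ℝ → ℂ}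
    (hz : SolvesZSystem n T α R p ρ k z) (ν : Fin n) {x : ℝ} (hx : x ∈ Set.Icc α T) :
    ‖z ν x - 1‖ ≤ 2 * (∑ m, ∫ t in α..T, ‖p m t‖) / ‖ρ‖ := by
  obtain ⟨-, ⟨M, hM⟩, hsol⟩ := hz
  have hρ0 : 0 < ‖ρ‖ := one_pos.trans_le hρ1
  have hI : ∀ m, 0 ≤ ∫ t in α..T, ‖p m t‖ := fun m =>
    intervalIntegral.integral_nonneg hαT fun _ _ => norm_nonneg _
  set P := ∑ m, ∫ t in α..T, ‖p m t‖ with hP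
  have hP0 : 0 ≤ P := Finset.sum_nonneg fun m _ => hI m
  have step : ∀ C, 0 ≤ C → (∀ ν, ∀ x ∈ Set.Icc α T, ‖z ν x‖ ≤ C) →
      ∀ ν, ∀ x ∈ Set.Icc α T, ‖z ν x - 1‖ ≤ P / ‖ρ‖ * C := by
    intro C hC0 hC ν x hx
    rw [hsol ν x hx, add_sub_cancel_left, hP, Finset.sum_div, Finset.sum_mul]
    refine norm_sum_le_of_le _ fun m _ =>
      (norm_integral_birkhoffKernel_mul_le hR hre ν m k x hαT (hp m) (hC _)).trans ?_
    gcongr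
    · exact hI m
    · exact le_self_pow₀ hρ1 (by have := m.isLt; omega)
  let s : Set ℝ := {r | ∃ ν, ∃ x ∈ Set.Icc α T, r = ‖z ν x‖}
  have hbdd : BddAbove s := ⟨M, by rintro _ ⟨ν, x, hx, rfl⟩; exact hM ν x hx⟩
  have hle : ∀ ν, ∀ x ∈ Set.Icc α T, ‖z ν x‖ ≤ sSup s := fun ν x hx =>
    le_csSup hbdd ⟨ν, x, hx, rfl⟩
  have hs0 : 0 ≤ sSup s := (norm_nonneg _).trans (hle ν x hx)
  have hhalf : P / ‖ρ‖ ≤ 1 / 2 := by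
    rw [div_le_iff₀ hρ0]
    linarith
  have hs2 : sSup s ≤ 2 := by
    have : sSup s ≤ 1 + 1 / 2 * sSup s := by
      refine csSup_le ⟨_, ν, x, hx, rfl⟩ ?_
      rintro _ ⟨ν, x, hx, rfl⟩
      calc ‖z ν x‖ = ‖1 + (z ν x - 1)‖ := by rw [add_sub_cancel]
        _ ≤ ‖(1 : ℂ)‖ + ‖z ν x - 1‖ := norm_add_le _ _
        _ ≤ 1 + 1 / 2 * sSup s := by
          rw [norm_one]
          gcongr
          exact (step _ hs0 hle ν x hx).trans (mul_le_mul_of_nonneg_right hhalf hs0)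
    linarith
  refine (step 2 zero_le_two (fun ν x hx => (hle ν x hx).trans hs2) ν x hx).trans_eq ?_
  ring

/-- The unique solution of the system (1.6) satisfies
`z_{νk}(x,ρ) = 1 + β₁(x)/(ρ R_k) + o(1/ρ)` as `|ρ| → ∞`, `ρ ∈ S̄`, uniformly in
`x ∈ [α,T]`, where `β₁(x) = −(1/n)∫_α^x p_{n−2}(t) dt`. -/
theorem z_system_second_order_asymptotics (n : ℕ) (hn : 2 ≤ n) (T α : ℝ) (hT : 0 < T)
    (hα : α ∈ Set.Ico 0 T)
    (R : Fin n → ℂ) (hinj : Function.Injective R) (hroot : ∀ j, R j ^ n = 1)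
    (p : Fin (n - 1) → ℝ → ℂ)
    (hp : ∀ m, IntervalIntegrable (p m) volume 0 T) :
    ∀ (S : Set ℂ), IsOpen S →
      (∀ ρ ∈ S, ∀ k l : Fin n, k < l → (ρ * R k).re < (ρ * R l).re) →
      ∀ ε > (0 : ℝ), ∃ ρ₀ : ℝ, ∀ ρ ∈ closure S, rhoAlpha n T α p ≤ ‖ρ‖ → ρ₀ ≤ ‖ρ‖ →
        ∀ k : Fin n, ∀ z : Fin n → ℝ → ℂ, SolvesZSystem n T α R p ρ k z →
          ∀ ν : Fin n, ∀ x ∈ Set.Icc α T,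
            ‖z ν x - (1 + (-(1 / (n : ℂ)) * ∫ t in α..x, p ⟨n - 2, by omega⟩ t) / (ρ * R k))‖
              ≤ ε / ‖ρ‖ := by
  intro S _ hS ε hε
  have hR : ∀ j, ‖R j‖ = 1 := fun j => Complex.norm_eq_one_of_pow_eq_one (hroot j) (by omega)
  have hαT : α ≤ T := hα.2.le
  have hpα : ∀ m, IntervalIntegrable (p m) volume α T := fun m => (hp m).mono_set (by
    rw [Set.uIcc_of_le hαT, Set.uIcc_of_le hT.le]
    exact Set.Icc_subset_Icc_left hα.1)
  set top : Fin (n - 1) := ⟨n - 2, by omega⟩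
  obtain ⟨N, hN0, hN⟩ := exists_norm_integral_mul_cexp_le (hpα top) (half_pos hε)
  have hI : ∀ m, 0 ≤ ∫ t in α..T, ‖p m t‖ := fun m =>
    intervalIntegral.integral_nonneg hαT fun _ _ => norm_nonneg _
  set P := ∑ m, ∫ t in α..T, ‖p m t‖ with hP
  have hP0 : 0 ≤ P := Finset.sum_nonneg fun m _ => hI m
  set D := ∑ j : Fin n, ∑ k : Fin n, N / ‖R j - R k‖
  have hD0 : 0 ≤ D := Finset.sum_nonneg fun j _ => Finset.sum_nonneg fun k _ => by positivity
  have hQ0 : 0 ≤ (P + 2 * P ^ 2) / (ε / 2) := by positivity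
  refine ⟨1 + 2 * P + D + (P + 2 * P ^ 2) / (ε / 2), fun ρ hρS _ hρ k z hz ν x hx => ?_⟩
  have hre : ∀ k l : Fin n, k ≤ l → (ρ * R k).re ≤ (ρ * R l).re := fun k l hkl =>
    re_mul_le_of_mem_closure hS hρS hkl
  have hρ1 : 1 ≤ ‖ρ‖ := by linarith
  have hρ0 : 0 < ‖ρ‖ := one_pos.trans_le hρ1
  have hone : ∀ ν, ∀ t ∈ Set.Icc α T, ‖z ν t - 1‖ ≤ 2 * P / ‖ρ‖ := fun ν t ht =>
    hz.norm_sub_one_le hR hre hαT hpα hρ1 (by linarith) ν ht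
  have hmain := norm_integral_birkhoffKernel_sub_le hR hroot hre ν (m := top)
    (Nat.sub_add_cancel hn) k hx (hpα top) (half_pos hε).le fun j hj c d s hc hcd hd h => by
      refine hN c d s hc hcd hd _ ?_ h
      have hjk : 0 < ‖R j - R k‖ := norm_pos_iff.2 (sub_ne_zero.2 (hinj.ne hj))
      have hle : N / ‖R j - R k‖ ≤ D :=
        (Finset.single_le_sum (f := fun k => N / ‖R j - R k‖) (fun k _ => by positivity)
          (Finset.mem_univ k)).trans
        (Finset.single_le_sum (f := fun j => ∑ k, N / ‖R j - R k‖)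
          (fun j _ => Finset.sum_nonneg fun k _ => by positivity) (Finset.mem_univ j))
      rw [norm_mul, ← div_le_iff₀ hjk]
      linarith
  have hsplit : ∀ m : Fin (n - 1),
      ∫ t in α..T, birkhoffKernel n R p ρ ν m k x t * z (Fin.castLE (Nat.sub_le n 1) m) t
        = (∫ t in α..T, birkhoffKernel n R p ρ ν m k x t)
          + ∫ t in α..T, birkhoffKernel n R p ρ ν m k x t
              * (z (Fin.castLE (Nat.sub_le n 1) m) t - 1) := by
    intro m
    have h1 := intervalIntegrable_birkhoffKernel_mul hR hre ν m k x hαT (hpα m)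
      measurable_one (C := 1) (by simp)
    simp only [Pi.one_apply, mul_one] at h1
    rw [← intervalIntegral.integral_add h1 (intervalIntegrable_birkhoffKernel_mul hR hre ν m k x
      hαT (hpα m) ((hz.1 _).sub_const 1) (hone _))]
    simp_rw [mul_sub_one, add_sub_cancel]
  have hlow : ∀ m ∈ Finset.univ.erase top,
      ‖∫ t in α..T, birkhoffKernel n R p ρ ν m k x t‖ ≤ (∫ t in α..T, ‖p m t‖) / ‖ρ‖ ^ 2 := by
    intro m hm
    have hne : (m : ℕ) ≠ n - 2 := fun h => (Finset.mem_erase.1 hm).1 (Fin.ext h)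
    have h := norm_integral_birkhoffKernel_mul_le hR hre ν m k x hαT (hpα m)
      (u := fun _ => 1) (C := 1) (by simp)
    simp only [mul_one] at h
    refine h.trans (div_le_div_of_nonneg_left (hI m) (by positivity)
      (pow_le_pow_right₀ hρ1 ?_))
    have := m.isLt
    omega
  have hcorr : ∀ m ∈ (Finset.univ : Finset (Fin (n - 1))),
      ‖∫ t in α..T, birkhoffKernel n R p ρ ν m k x t
        * (z (Fin.castLE (Nat.sub_le n 1) m) t - 1)‖
        ≤ (∫ t in α..T, ‖p m t‖) / ‖ρ‖ * (2 * P / ‖ρ‖) := by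
    intro m _
    refine (norm_integral_birkhoffKernel_mul_le hR hre ν m k x hαT (hpα m) (hone _)).trans ?_
    gcongr
    · exact hI m
    · exact le_self_pow₀ hρ1 (by have := m.isLt; omega)
  have hlow' : ∑ m ∈ Finset.univ.erase top, (∫ t in α..T, ‖p m t‖) / ‖ρ‖ ^ 2
      ≤ P / ‖ρ‖ ^ 2 := by
    rw [← Finset.sum_div]
    gcongr
    exact Finset.sum_le_sum_of_subset_of_nonneg (Finset.erase_subset _ _) fun m _ _ => hI m
  have hcorr' : ∑ m, (∫ t in α..T, ‖p m t‖) / ‖ρ‖ * (2 * P / ‖ρ‖) = 2 * P ^ 2 / ‖ρ‖ ^ 2 := by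
    rw [← Finset.sum_mul, ← Finset.sum_div, ← hP]
    field_simp
  have hsmall : P / ‖ρ‖ ^ 2 + 2 * P ^ 2 / ‖ρ‖ ^ 2 ≤ ε / 2 / ‖ρ‖ := by
    have h : (P + 2 * P ^ 2) / (ε / 2) ≤ ‖ρ‖ := by linarith
    rw [div_le_iff₀ (half_pos hε)] at h
    rw [← add_div, div_le_div_iff₀ (by positivity) hρ0]
    nlinarith
  rw [hz.2.2 ν x hx, add_sub_add_left_eq_sub]
  simp_rw [hsplit]
  rw [Finset.sum_add_distrib, ← Finset.add_sum_erase _ _ (Finset.mem_univ top), add_assoc,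
    add_sub_right_comm]
  refine (norm_add_le _ _).trans ((add_le_add hmain ((norm_add_le _ _).trans
    (add_le_add ((norm_sum_le_of_le _ hlow).trans hlow')
      ((norm_sum_le_of_le _ hcorr).trans_eq hcorr')))).trans ?_)
  calc _ ≤ ε / 2 / ‖ρ‖ + ε / 2 / ‖ρ‖ := by gcongr
    _ = ε / ‖ρ‖ := by ring
end
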